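/- G4CK eliminates cut and G4WK eliminates cut: every sequent provable in G4CK augmented with the additive cut rule (from Γ ⇒ φ and Γ,φ ⇒ Δ infer Γ ⇒ Δ) is provable in G4CK, and every sequent provable in G4WK augmented with the additive cut rule is provable in G4WK. -/

import Mathlib

/-- Formulas of the modal language: φ ::= p | ⊥ | φ∧φ | φ∨φ | φ→φ | □φ | ◇φ. -/
inductive Form : Type
  | var : ℕ → Form
  | bot : Form
  | and : Form → Form → Form
  | or  : Form → Form → Form
  | imp : Form → Form → Form
  | box : Form → Form
  | dia : Form → Form
  deriving DecidableEq

/-- Helper for □⁻¹: remove an outer box. -/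
def unboxF : Form → Option Form
  | Form.box φ => some φ
  | _ => none

/-- □⁻¹Γ := {φ | □φ ∈ Γ}, as a multiset operation. -/
def boxInv (Γ : Multiset Form) : Multiset Form := Γ.filterMap unboxF

/-- ◇⁻¹Δ for a succedent Δ with at most one formula (modelled by `Option`). -/
def diaInv : Option Form → Option Form
  | some (Form.dia φ) => some φ
  | _ => none

/-- Provability in the sequent calculus G4CK: sequents Γ ⇒ δ with a
multiset antecedent and a single-formula succedent. -/
inductive G4CK : Multiset Form → Form → Prop
  | botL (Γ δ) : G4CK (Form.bot ::ₘ Γ) δ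
  | idP (Γ n) : G4CK (Form.var n ::ₘ Γ) (Form.var n)
  | andL (Γ φ ψ δ) : G4CK (φ ::ₘ ψ ::ₘ Γ) δ → G4CK (Form.and φ ψ ::ₘ Γ) δ
  | andR (Γ φ ψ) : G4CK Γ φ → G4CK Γ ψ → G4CK Γ (Form.and φ ψ)
  | orL (Γ φ ψ δ) : G4CK (φ ::ₘ Γ) δ → G4CK (ψ ::ₘ Γ) δ → G4CK (Form.or φ ψ ::ₘ Γ) δ
  | orR1 (Γ φ ψ) : G4CK Γ φ → G4CK Γ (Form.or φ ψ)
  | orR2 (Γ φ ψ) : G4CK Γ ψ → G4CK Γ (Form.or φ ψ)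
  | impR (Γ φ ψ) : G4CK (φ ::ₘ Γ) ψ → G4CK Γ (Form.imp φ ψ)
  | andImpL (Γ φ ψ χ δ) :
      G4CK (Form.imp φ (Form.imp ψ χ) ::ₘ Γ) δ →
      G4CK (Form.imp (Form.and φ ψ) χ ::ₘ Γ) δ
  | orImpL (Γ φ ψ χ δ) :
      G4CK (Form.imp φ χ ::ₘ Form.imp ψ χ ::ₘ Γ) δ →
      G4CK (Form.imp (Form.or φ ψ) χ ::ₘ Γ) δ
  | pImpL (Γ n φ δ) :
      G4CK (Form.var n ::ₘ φ ::ₘ Γ) δ →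
      G4CK (Form.var n ::ₘ Form.imp (Form.var n) φ ::ₘ Γ) δ
  | impImpL (Γ φ ψ χ δ) :
      G4CK (Form.imp ψ χ ::ₘ Γ) (Form.imp φ ψ) → G4CK (χ ::ₘ Γ) δ →
      G4CK (Form.imp (Form.imp φ ψ) χ ::ₘ Γ) δ
  | boxR (Γ φ) : G4CK (boxInv Γ) φ → G4CK Γ (Form.box φ)
  | boxImpL (Γ φ ψ δ) :
      G4CK (boxInv Γ) φ → G4CK (ψ ::ₘ Γ) δ →
      G4CK (Form.imp (Form.box φ) ψ ::ₘ Γ) δ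
  | diaImpL (Γ γ φ ψ δ) :
      G4CK (γ ::ₘ boxInv Γ) φ → G4CK (ψ ::ₘ Form.dia γ ::ₘ Γ) δ →
      G4CK (Form.imp (Form.dia φ) ψ ::ₘ Form.dia γ ::ₘ Γ) δ
  | diaL (Γ φ ψ) : G4CK (φ ::ₘ boxInv Γ) ψ → G4CK (Form.dia φ ::ₘ Γ) (Form.dia ψ)

/-- Provability in the sequent calculus G4WK: sequents Γ ⇒ Δ with a
multiset antecedent and a succedent with at most one formula (`Option Form`). -/
inductive G4WK : Multiset Form → Option Form → Prop
  | botL (Γ Δ) : G4WK (Form.bot ::ₘ Γ) Δ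
  | idP (Γ n) : G4WK (Form.var n ::ₘ Γ) (some (Form.var n))
  | andL (Γ φ ψ Δ) : G4WK (φ ::ₘ ψ ::ₘ Γ) Δ → G4WK (Form.and φ ψ ::ₘ Γ) Δ
  | andR (Γ φ ψ) : G4WK Γ (some φ) → G4WK Γ (some ψ) → G4WK Γ (some (Form.and φ ψ))
  | orL (Γ φ ψ Δ) : G4WK (φ ::ₘ Γ) Δ → G4WK (ψ ::ₘ Γ) Δ → G4WK (Form.or φ ψ ::ₘ Γ) Δ
  | orR1 (Γ φ ψ) : G4WK Γ (some φ) → G4WK Γ (some (Form.or φ ψ))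
  | orR2 (Γ φ ψ) : G4WK Γ (some ψ) → G4WK Γ (some (Form.or φ ψ))
  | impR (Γ φ ψ) : G4WK (φ ::ₘ Γ) (some ψ) → G4WK Γ (some (Form.imp φ ψ))
  | andImpL (Γ φ ψ χ Δ) :
      G4WK (Form.imp φ (Form.imp ψ χ) ::ₘ Γ) Δ →
      G4WK (Form.imp (Form.and φ ψ) χ ::ₘ Γ) Δ
  | orImpL (Γ φ ψ χ Δ) :
      G4WK (Form.imp φ χ ::ₘ Form.imp ψ χ ::ₘ Γ) Δ →
      G4WK (Form.imp (Form.or φ ψ) χ ::ₘ Γ) Δ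
  | pImpL (Γ n φ Δ) :
      G4WK (Form.var n ::ₘ φ ::ₘ Γ) Δ →
      G4WK (Form.var n ::ₘ Form.imp (Form.var n) φ ::ₘ Γ) Δ
  | impImpL (Γ φ ψ χ Δ) :
      G4WK (Form.imp ψ χ ::ₘ Γ) (some (Form.imp φ ψ)) → G4WK (χ ::ₘ Γ) Δ →
      G4WK (Form.imp (Form.imp φ ψ) χ ::ₘ Γ) Δ
  | boxR (Γ φ) : G4WK (boxInv Γ) (some φ) → G4WK Γ (some (Form.box φ))
  | boxImpL (Γ φ ψ Δ) :
      G4WK (boxInv Γ) (some φ) → G4WK (ψ ::ₘ Γ) Δ →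
      G4WK (Form.imp (Form.box φ) ψ ::ₘ Γ) Δ
  | diaImpL (Γ γ φ ψ Δ) :
      G4WK (γ ::ₘ boxInv Γ) (some φ) → G4WK (ψ ::ₘ Form.dia γ ::ₘ Γ) Δ →
      G4WK (Form.imp (Form.dia φ) ψ ::ₘ Form.dia γ ::ₘ Γ) Δ
  | diaL' (Γ φ Δ) : G4WK (φ ::ₘ boxInv Γ) (diaInv Δ) → G4WK (Form.dia φ ::ₘ Γ) Δ

/-- Axiom schemes of the generalised Hilbert calculus CKH:
intuitionistic axioms A1–A9 together with K_□ and K_◇. -/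
inductive CKAx : Form → Prop
  | a1 (φ ψ : Form) : CKAx (φ.imp (ψ.imp φ))
  | a2 (φ ψ χ : Form) : CKAx ((φ.imp (ψ.imp χ)).imp ((φ.imp ψ).imp (φ.imp χ)))
  | a3 (φ ψ : Form) : CKAx (φ.imp (φ.or ψ))
  | a4 (φ ψ : Form) : CKAx (ψ.imp (φ.or ψ))
  | a5 (φ ψ χ : Form) : CKAx ((φ.imp χ).imp ((ψ.imp χ).imp ((φ.or ψ).imp χ)))
  | a6 (φ ψ : Form) : CKAx ((φ.and ψ).imp φ)
  | a7 (φ ψ : Form) : CKAx ((φ.and ψ).imp ψ)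
  | a8 (φ ψ χ : Form) : CKAx ((φ.imp ψ).imp ((φ.imp χ).imp (φ.imp (ψ.and χ))))
  | a9 (φ : Form) : CKAx (Form.bot.imp φ)
  | kbox (φ ψ : Form) : CKAx ((φ.imp ψ).box.imp (φ.box.imp ψ.box))
  | kdia (φ ψ : Form) : CKAx ((φ.imp ψ).box.imp (φ.dia.imp ψ.dia))

/-- Axiom schemes of WKH: those of CKH together with N : ¬◇⊥. -/
inductive WKAx : Form → Prop
  | ck {φ : Form} : CKAx φ → WKAx φ
  | n : WKAx (Form.bot.dia.imp Form.bot)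

/-- Derivability Γ ⊢ φ in the generalised Hilbert calculus CKH. -/
inductive CKH : Set Form → Form → Prop
  | ax {Γ : Set Form} {φ : Form} : CKAx φ → CKH Γ φ
  | el {Γ : Set Form} {φ : Form} : φ ∈ Γ → CKH Γ φ
  | mp {Γ : Set Form} {φ ψ : Form} : CKH Γ φ → CKH Γ (φ.imp ψ) → CKH Γ ψ
  | nec {Γ : Set Form} {φ : Form} : CKH ∅ φ → CKH Γ φ.box

/-- Derivability Γ ⊢ φ in the generalised Hilbert calculus WKH. -/
inductive WKH : Set Form → Form → Prop
  | ax {Γ : Set Form} {φ : Form} : WKAx φ → WKH Γ φ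
  | el {Γ : Set Form} {φ : Form} : φ ∈ Γ → WKH Γ φ
  | mp {Γ : Set Form} {φ ψ : Form} : WKH Γ φ → WKH Γ (φ.imp ψ) → WKH Γ ψ
  | nec {Γ : Set Form} {φ : Form} : WKH ∅ φ → WKH Γ φ.box

/-- The set of propositional variables occurring in a formula. -/
def vars : Form → Set ℕ
  | .var n => {n}
  | .bot => ∅
  | .and φ ψ => vars φ ∪ vars ψ
  | .or φ ψ => vars φ ∪ vars ψ
  | .imp φ ψ => vars φ ∪ vars ψ
  | .box φ => vars φ
  | .dia φ => vars φ

/-- Variables occurring in a multiset of formulas. -/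
def varsM (Γ : Multiset Form) : Set ℕ := {n | ∃ φ ∈ Γ, n ∈ vars φ}

/-- Variables occurring in a succedent with at most one formula. -/
def varsO : Option Form → Set ℕ
  | none => ∅
  | some φ => vars φ

/-- Provability in G4CK augmented with the additive cut rule. -/
inductive G4CKc : Multiset Form → Form → Prop
  | botL (Γ δ) : G4CKc (Form.bot ::ₘ Γ) δ
  | idP (Γ n) : G4CKc (Form.var n ::ₘ Γ) (Form.var n)
  | andL (Γ φ ψ δ) : G4CKc (φ ::ₘ ψ ::ₘ Γ) δ → G4CKc (Form.and φ ψ ::ₘ Γ) δ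
  | andR (Γ φ ψ) : G4CKc Γ φ → G4CKc Γ ψ → G4CKc Γ (Form.and φ ψ)
  | orL (Γ φ ψ δ) : G4CKc (φ ::ₘ Γ) δ → G4CKc (ψ ::ₘ Γ) δ → G4CKc (Form.or φ ψ ::ₘ Γ) δ
  | orR1 (Γ φ ψ) : G4CKc Γ φ → G4CKc Γ (Form.or φ ψ)
  | orR2 (Γ φ ψ) : G4CKc Γ ψ → G4CKc Γ (Form.or φ ψ)
  | impR (Γ φ ψ) : G4CKc (φ ::ₘ Γ) ψ → G4CKc Γ (Form.imp φ ψ)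
  | andImpL (Γ φ ψ χ δ) :
      G4CKc (Form.imp φ (Form.imp ψ χ) ::ₘ Γ) δ →
      G4CKc (Form.imp (Form.and φ ψ) χ ::ₘ Γ) δ
  | orImpL (Γ φ ψ χ δ) :
      G4CKc (Form.imp φ χ ::ₘ Form.imp ψ χ ::ₘ Γ) δ →
      G4CKc (Form.imp (Form.or φ ψ) χ ::ₘ Γ) δ
  | pImpL (Γ n φ δ) :
      G4CKc (Form.var n ::ₘ φ ::ₘ Γ) δ →
      G4CKc (Form.var n ::ₘ Form.imp (Form.var n) φ ::ₘ Γ) δ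
  | impImpL (Γ φ ψ χ δ) :
      G4CKc (Form.imp ψ χ ::ₘ Γ) (Form.imp φ ψ) → G4CKc (χ ::ₘ Γ) δ →
      G4CKc (Form.imp (Form.imp φ ψ) χ ::ₘ Γ) δ
  | boxR (Γ φ) : G4CKc (boxInv Γ) φ → G4CKc Γ (Form.box φ)
  | boxImpL (Γ φ ψ δ) :
      G4CKc (boxInv Γ) φ → G4CKc (ψ ::ₘ Γ) δ →
      G4CKc (Form.imp (Form.box φ) ψ ::ₘ Γ) δ
  | diaImpL (Γ γ φ ψ δ) :
      G4CKc (γ ::ₘ boxInv Γ) φ → G4CKc (ψ ::ₘ Form.dia γ ::ₘ Γ) δ →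
      G4CKc (Form.imp (Form.dia φ) ψ ::ₘ Form.dia γ ::ₘ Γ) δ
  | diaL (Γ φ ψ) : G4CKc (φ ::ₘ boxInv Γ) ψ → G4CKc (Form.dia φ ::ₘ Γ) (Form.dia ψ)
  | cut (Γ φ δ) : G4CKc Γ φ → G4CKc (φ ::ₘ Γ) δ → G4CKc Γ δ

/-- Provability in G4WK augmented with the additive cut rule. -/
inductive G4WKc : Multiset Form → Option Form → Prop
  | botL (Γ Δ) : G4WKc (Form.bot ::ₘ Γ) Δ
  | idP (Γ n) : G4WKc (Form.var n ::ₘ Γ) (some (Form.var n))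
  | andL (Γ φ ψ Δ) : G4WKc (φ ::ₘ ψ ::ₘ Γ) Δ → G4WKc (Form.and φ ψ ::ₘ Γ) Δ
  | andR (Γ φ ψ) : G4WKc Γ (some φ) → G4WKc Γ (some ψ) → G4WKc Γ (some (Form.and φ ψ))
  | orL (Γ φ ψ Δ) : G4WKc (φ ::ₘ Γ) Δ → G4WKc (ψ ::ₘ Γ) Δ → G4WKc (Form.or φ ψ ::ₘ Γ) Δ
  | orR1 (Γ φ ψ) : G4WKc Γ (some φ) → G4WKc Γ (some (Form.or φ ψ))
  | orR2 (Γ φ ψ) : G4WKc Γ (some ψ) → G4WKc Γ (some (Form.or φ ψ))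
  | impR (Γ φ ψ) : G4WKc (φ ::ₘ Γ) (some ψ) → G4WKc Γ (some (Form.imp φ ψ))
  | andImpL (Γ φ ψ χ Δ) :
      G4WKc (Form.imp φ (Form.imp ψ χ) ::ₘ Γ) Δ →
      G4WKc (Form.imp (Form.and φ ψ) χ ::ₘ Γ) Δ
  | orImpL (Γ φ ψ χ Δ) :
      G4WKc (Form.imp φ χ ::ₘ Form.imp ψ χ ::ₘ Γ) Δ →
      G4WKc (Form.imp (Form.or φ ψ) χ ::ₘ Γ) Δ
  | pImpL (Γ n φ Δ) :
      G4WKc (Form.var n ::ₘ φ ::ₘ Γ) Δ →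
      G4WKc (Form.var n ::ₘ Form.imp (Form.var n) φ ::ₘ Γ) Δ
  | impImpL (Γ φ ψ χ Δ) :
      G4WKc (Form.imp ψ χ ::ₘ Γ) (some (Form.imp φ ψ)) → G4WKc (χ ::ₘ Γ) Δ →
      G4WKc (Form.imp (Form.imp φ ψ) χ ::ₘ Γ) Δ
  | boxR (Γ φ) : G4WKc (boxInv Γ) (some φ) → G4WKc Γ (some (Form.box φ))
  | boxImpL (Γ φ ψ Δ) :
      G4WKc (boxInv Γ) (some φ) → G4WKc (ψ ::ₘ Γ) Δ →
      G4WKc (Form.imp (Form.box φ) ψ ::ₘ Γ) Δ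
  | diaImpL (Γ γ φ ψ Δ) :
      G4WKc (γ ::ₘ boxInv Γ) (some φ) → G4WKc (ψ ::ₘ Form.dia γ ::ₘ Γ) Δ →
      G4WKc (Form.imp (Form.dia φ) ψ ::ₘ Form.dia γ ::ₘ Γ) Δ
  | diaL' (Γ φ Δ) : G4WKc (φ ::ₘ boxInv Γ) (diaInv Δ) → G4WKc (Form.dia φ ::ₘ Γ) Δ
  | cut (Γ φ Δ) : G4WKc Γ (some φ) → G4WKc (φ ::ₘ Γ) Δ → G4WKc Γ Δ

theorem mem_boxInv {Γ : Multiset Form} {φ : Form} : φ ∈ boxInv Γ ↔ Form.box φ ∈ Γ := by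
  unfold boxInv
  rw [Multiset.mem_filterMap]
  constructor
  · rintro ⟨a, ha, h⟩
    cases a <;> simp [unboxF] at h
    subst h
    exact ha
  · intro h
    exact ⟨_, h, rfl⟩

theorem boxInv_add (Γ Γ' : Multiset Form) : boxInv (Γ + Γ') = boxInv Γ + boxInv Γ' :=
  Multiset.filterMap_add _ _ _

theorem boxInv_cons_box (Γ : Multiset Form) (φ : Form) :
    boxInv (φ.box ::ₘ Γ) = φ ::ₘ boxInv Γ :=
  Multiset.filterMap_cons_some _ _ _ rfl

/-- A common presentation of the four calculi. The flag `w` selects the stronger left rule for `◇`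
of G4WK, and the flag `c` allows the cut rule. -/
inductive G4 (w c : Bool) : Multiset Form → Option Form → Prop
  | botL (Γ Δ) : G4 w c (Form.bot ::ₘ Γ) Δ
  | idP (Γ n) : G4 w c (Form.var n ::ₘ Γ) (some (Form.var n))
  | andL (Γ φ ψ Δ) : G4 w c (φ ::ₘ ψ ::ₘ Γ) Δ → G4 w c (Form.and φ ψ ::ₘ Γ) Δ
  | andR (Γ φ ψ) : G4 w c Γ (some φ) → G4 w c Γ (some ψ) → G4 w c Γ (some (Form.and φ ψ))
  | orL (Γ φ ψ Δ) : G4 w c (φ ::ₘ Γ) Δ → G4 w c (ψ ::ₘ Γ) Δ → G4 w c (Form.or φ ψ ::ₘ Γ) Δ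
  | orR1 (Γ φ ψ) : G4 w c Γ (some φ) → G4 w c Γ (some (Form.or φ ψ))
  | orR2 (Γ φ ψ) : G4 w c Γ (some ψ) → G4 w c Γ (some (Form.or φ ψ))
  | impR (Γ φ ψ) : G4 w c (φ ::ₘ Γ) (some ψ) → G4 w c Γ (some (Form.imp φ ψ))
  | andImpL (Γ φ ψ χ Δ) :
      G4 w c (Form.imp φ (Form.imp ψ χ) ::ₘ Γ) Δ →
      G4 w c (Form.imp (Form.and φ ψ) χ ::ₘ Γ) Δ
  | orImpL (Γ φ ψ χ Δ) :
      G4 w c (Form.imp φ χ ::ₘ Form.imp ψ χ ::ₘ Γ) Δ →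
      G4 w c (Form.imp (Form.or φ ψ) χ ::ₘ Γ) Δ
  | pImpL (Γ n φ Δ) :
      G4 w c (Form.var n ::ₘ φ ::ₘ Γ) Δ →
      G4 w c (Form.var n ::ₘ Form.imp (Form.var n) φ ::ₘ Γ) Δ
  | impImpL (Γ φ ψ χ Δ) :
      G4 w c (Form.imp ψ χ ::ₘ Γ) (some (Form.imp φ ψ)) → G4 w c (χ ::ₘ Γ) Δ →
      G4 w c (Form.imp (Form.imp φ ψ) χ ::ₘ Γ) Δ
  | boxR (Γ φ) : G4 w c (boxInv Γ) (some φ) → G4 w c Γ (some (Form.box φ))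
  | boxImpL (Γ φ ψ Δ) :
      G4 w c (boxInv Γ) (some φ) → G4 w c (ψ ::ₘ Γ) Δ →
      G4 w c (Form.imp (Form.box φ) ψ ::ₘ Γ) Δ
  | diaImpL (Γ γ φ ψ Δ) :
      G4 w c (γ ::ₘ boxInv Γ) (some φ) → G4 w c (ψ ::ₘ Form.dia γ ::ₘ Γ) Δ →
      G4 w c (Form.imp (Form.dia φ) ψ ::ₘ Form.dia γ ::ₘ Γ) Δ
  | diaL (Γ φ ψ) :
      G4 w c (φ ::ₘ boxInv Γ) (some ψ) → G4 w c (Form.dia φ ::ₘ Γ) (some (Form.dia ψ))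
  | diaN (Γ φ Δ) : w = true →
      G4 w c (φ ::ₘ boxInv Γ) (diaInv Δ) → G4 w c (Form.dia φ ::ₘ Γ) Δ
  | cut (Γ φ Δ) : c = true → G4 w c Γ (some φ) → G4 w c (φ ::ₘ Γ) Δ → G4 w c Γ Δ

theorem G4CKc.toG4 {Γ : Multiset Form} {δ : Form} (h : G4CKc Γ δ) :
    G4 false true Γ (some δ) := by
  induction h with
  | botL => exact .botL _ _
  | idP => exact .idP _ _
  | andL _ _ _ _ _ h => exact .andL _ _ _ _ h
  | andR _ _ _ _ _ h k => exact .andR _ _ _ h k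
  | orL _ _ _ _ _ _ h k => exact .orL _ _ _ _ h k
  | orR1 _ _ _ _ h => exact .orR1 _ _ _ h
  | orR2 _ _ _ _ h => exact .orR2 _ _ _ h
  | impR _ _ _ _ h => exact .impR _ _ _ h
  | andImpL _ _ _ _ _ _ h => exact .andImpL _ _ _ _ _ h
  | orImpL _ _ _ _ _ _ h => exact .orImpL _ _ _ _ _ h
  | pImpL _ _ _ _ _ h => exact .pImpL _ _ _ _ h
  | impImpL _ _ _ _ _ _ _ h k => exact .impImpL _ _ _ _ _ h k
  | boxR _ _ _ h => exact .boxR _ _ h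
  | boxImpL _ _ _ _ _ _ h k => exact .boxImpL _ _ _ _ h k
  | diaImpL _ _ _ _ _ _ _ h k => exact .diaImpL _ _ _ _ _ h k
  | diaL _ _ _ _ h => exact .diaL _ _ _ h
  | cut _ _ _ _ _ h k => exact .cut _ _ _ rfl h k

theorem G4WKc.toG4 {Γ : Multiset Form} {Δ : Option Form} (h : G4WKc Γ Δ) :
    G4 true true Γ Δ := by
  induction h with
  | botL => exact .botL _ _
  | idP => exact .idP _ _
  | andL _ _ _ _ _ h => exact .andL _ _ _ _ h
  | andR _ _ _ _ _ h k => exact .andR _ _ _ h k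
  | orL _ _ _ _ _ _ h k => exact .orL _ _ _ _ h k
  | orR1 _ _ _ _ h => exact .orR1 _ _ _ h
  | orR2 _ _ _ _ h => exact .orR2 _ _ _ h
  | impR _ _ _ _ h => exact .impR _ _ _ h
  | andImpL _ _ _ _ _ _ h => exact .andImpL _ _ _ _ _ h
  | orImpL _ _ _ _ _ _ h => exact .orImpL _ _ _ _ _ h
  | pImpL _ _ _ _ _ h => exact .pImpL _ _ _ _ h
  | impImpL _ _ _ _ _ _ _ h k => exact .impImpL _ _ _ _ _ h k
  | boxR _ _ _ h => exact .boxR _ _ h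
  | boxImpL _ _ _ _ _ _ h k => exact .boxImpL _ _ _ _ h k
  | diaImpL _ _ _ _ _ _ _ h k => exact .diaImpL _ _ _ _ _ h k
  | diaL' _ _ _ _ h => exact .diaN _ _ _ rfl h
  | cut _ _ _ _ _ h k => exact .cut _ _ _ rfl h k

theorem G4.toG4CK {Γ : Multiset Form} {Δ : Option Form} (h : G4 false false Γ Δ) :
    ∀ δ, Δ = some δ → G4CK Γ δ := by
  induction h with
  | botL => exact fun _ _ => .botL _ _
  | idP => rintro _ ⟨⟩; exact .idP _ _
  | andL _ _ _ _ _ h => exact fun δ e => .andL _ _ _ _ (h δ e)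
  | andR _ _ _ _ _ h k => rintro _ ⟨⟩; exact .andR _ _ _ (h _ rfl) (k _ rfl)
  | orL _ _ _ _ _ _ h k => exact fun δ e => .orL _ _ _ _ (h δ e) (k δ e)
  | orR1 _ _ _ _ h => rintro _ ⟨⟩; exact .orR1 _ _ _ (h _ rfl)
  | orR2 _ _ _ _ h => rintro _ ⟨⟩; exact .orR2 _ _ _ (h _ rfl)
  | impR _ _ _ _ h => rintro _ ⟨⟩; exact .impR _ _ _ (h _ rfl)
  | andImpL _ _ _ _ _ _ h => exact fun δ e => .andImpL _ _ _ _ _ (h δ e)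
  | orImpL _ _ _ _ _ _ h => exact fun δ e => .orImpL _ _ _ _ _ (h δ e)
  | pImpL _ _ _ _ _ h => exact fun δ e => .pImpL _ _ _ _ (h δ e)
  | impImpL _ _ _ _ _ _ _ h k => exact fun δ e => .impImpL _ _ _ _ _ (h _ rfl) (k δ e)
  | boxR _ _ _ h => rintro _ ⟨⟩; exact .boxR _ _ (h _ rfl)
  | boxImpL _ _ _ _ _ _ h k => exact fun δ e => .boxImpL _ _ _ _ (h _ rfl) (k δ e)
  | diaImpL _ _ _ _ _ _ _ h k => exact fun δ e => .diaImpL _ _ _ _ _ (h _ rfl) (k δ e)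
  | diaL _ _ _ _ h => rintro _ ⟨⟩; exact .diaL _ _ _ (h _ rfl)
  | diaN _ _ _ e => cases e
  | cut _ _ _ e => cases e

theorem G4.toG4WK {Γ : Multiset Form} {Δ : Option Form} (h : G4 true false Γ Δ) :
    G4WK Γ Δ := by
  induction h with
  | botL => exact .botL _ _
  | idP => exact .idP _ _
  | andL _ _ _ _ _ h => exact .andL _ _ _ _ h
  | andR _ _ _ _ _ h k => exact .andR _ _ _ h k
  | orL _ _ _ _ _ _ h k => exact .orL _ _ _ _ h k
  | orR1 _ _ _ _ h => exact .orR1 _ _ _ h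
  | orR2 _ _ _ _ h => exact .orR2 _ _ _ h
  | impR _ _ _ _ h => exact .impR _ _ _ h
  | andImpL _ _ _ _ _ _ h => exact .andImpL _ _ _ _ _ h
  | orImpL _ _ _ _ _ _ h => exact .orImpL _ _ _ _ _ h
  | pImpL _ _ _ _ _ h => exact .pImpL _ _ _ _ h
  | impImpL _ _ _ _ _ _ _ h k => exact .impImpL _ _ _ _ _ h k
  | boxR _ _ _ h => exact .boxR _ _ h
  | boxImpL _ _ _ _ _ _ h k => exact .boxImpL _ _ _ _ h k
  | diaImpL _ _ _ _ _ _ _ h k => exact .diaImpL _ _ _ _ _ h k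
  | diaL _ _ _ _ h => exact .diaL' _ _ _ h
  | diaN _ _ _ _ _ h => exact .diaL' _ _ _ h
  | cut _ _ _ e => cases e

namespace G4

variable {w c : Bool} {Γ Γ' : Multiset Form} {Δ : Option Form} {φ ψ χ : Form}

/-! ### Structural rules -/

theorem weaken_add (h : G4 w c Γ Δ) : ∀ Γ', G4 w c (Γ + Γ') Δ := by
  induction h with
  | botL => intro Γ'; rw [Multiset.cons_add]; exact .botL _ _
  | idP => intro Γ'; rw [Multiset.cons_add]; exact .idP _ _
  | andL _ _ _ _ _ h =>
    intro Γ'; have h := h Γ'; simp only [Multiset.cons_add] at *; exact .andL _ _ _ _ h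
  | andR _ _ _ _ _ h k => exact fun Γ' => .andR _ _ _ (h Γ') (k Γ')
  | orL _ _ _ _ _ _ h k =>
    intro Γ'; have h := h Γ'; have k := k Γ'
    simp only [Multiset.cons_add] at *; exact .orL _ _ _ _ h k
  | orR1 _ _ _ _ h => exact fun Γ' => .orR1 _ _ _ (h Γ')
  | orR2 _ _ _ _ h => exact fun Γ' => .orR2 _ _ _ (h Γ')
  | impR _ _ _ _ h =>
    intro Γ'; have h := h Γ'; simp only [Multiset.cons_add] at *; exact .impR _ _ _ h
  | andImpL _ _ _ _ _ _ h =>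
    intro Γ'; have h := h Γ'; simp only [Multiset.cons_add] at *; exact .andImpL _ _ _ _ _ h
  | orImpL _ _ _ _ _ _ h =>
    intro Γ'; have h := h Γ'; simp only [Multiset.cons_add] at *; exact .orImpL _ _ _ _ _ h
  | pImpL _ _ _ _ _ h =>
    intro Γ'; have h := h Γ'; simp only [Multiset.cons_add] at *; exact .pImpL _ _ _ _ h
  | impImpL _ _ _ _ _ _ _ h k =>
    intro Γ'; have h := h Γ'; have k := k Γ'
    simp only [Multiset.cons_add] at *; exact .impImpL _ _ _ _ _ h k
  | boxR _ _ _ h =>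
    intro Γ'; have h := h (boxInv Γ'); rw [← boxInv_add] at h; exact .boxR _ _ h
  | boxImpL _ _ _ _ _ _ h k =>
    intro Γ'; have h := h (boxInv Γ'); have k := k Γ'
    simp only [Multiset.cons_add, ← boxInv_add] at *; exact .boxImpL _ _ _ _ h k
  | diaImpL _ _ _ _ _ _ _ h k =>
    intro Γ'; have h := h (boxInv Γ'); have k := k Γ'
    simp only [Multiset.cons_add, ← boxInv_add] at *; exact .diaImpL _ _ _ _ _ h k
  | diaL _ _ _ _ h =>
    intro Γ'; have h := h (boxInv Γ')
    simp only [Multiset.cons_add, ← boxInv_add] at *; exact .diaL _ _ _ h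
  | diaN _ _ _ e _ h =>
    intro Γ'; have h := h (boxInv Γ')
    simp only [Multiset.cons_add, ← boxInv_add] at *; exact .diaN _ _ _ e h
  | cut _ _ _ e _ _ h k =>
    intro Γ'; have h := h Γ'; have k := k Γ'
    simp only [Multiset.cons_add] at *; exact .cut _ _ _ e h k

theorem weaken (φ : Form) (h : G4 w c Γ Δ) : G4 w c (φ ::ₘ Γ) Δ := by
  have := h.weaken_add {φ}
  rwa [Multiset.add_comm, Multiset.singleton_add] at this

theorem weaken_right (h : G4 w c Γ Δ) : Δ = none → ∀ Δ', G4 w c Γ Δ' := by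
  induction h with
  | botL => exact fun _ _ => .botL _ _
  | andL _ _ _ _ _ h => exact fun e Δ => .andL _ _ _ _ (h e Δ)
  | orL _ _ _ _ _ _ h k => exact fun e Δ => .orL _ _ _ _ (h e Δ) (k e Δ)
  | andImpL _ _ _ _ _ _ h => exact fun e Δ => .andImpL _ _ _ _ _ (h e Δ)
  | orImpL _ _ _ _ _ _ h => exact fun e Δ => .orImpL _ _ _ _ _ (h e Δ)
  | pImpL _ _ _ _ _ h => exact fun e Δ => .pImpL _ _ _ _ (h e Δ)
  | impImpL _ _ _ _ _ h _ _ k => exact fun e Δ => .impImpL _ _ _ _ _ h (k e Δ)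
  | boxImpL _ _ _ _ h _ _ k => exact fun e Δ => .boxImpL _ _ _ _ h (k e Δ)
  | diaImpL _ _ _ _ _ h _ _ k => exact fun e Δ => .diaImpL _ _ _ _ _ h (k e Δ)
  | diaN _ _ _ e' _ h => rintro rfl Δ; exact .diaN _ _ _ e' (h rfl _)
  | cut _ _ _ e' h _ _ k => exact fun e Δ => .cut _ _ _ e' h (k e Δ)
  | _ => exact fun e => nomatch e

theorem id_and_impL (φ : Form) :
    (∀ Γ, G4 w c (φ ::ₘ Γ) (some φ)) ∧
    (∀ Γ ψ Δ, G4 w c (ψ ::ₘ Γ) Δ → G4 w c (φ ::ₘ Form.imp φ ψ ::ₘ Γ) Δ) := by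
  induction φ with
  | var n => exact ⟨fun _ => .idP _ _, fun _ _ _ h => .pImpL _ _ _ _ (h.weaken _)⟩
  | bot => exact ⟨fun _ => .botL _ _, fun _ _ _ _ => .botL _ _⟩
  | and φ₁ φ₂ h₁ h₂ =>
    refine ⟨fun Γ => .andL _ _ _ _ (.andR _ _ _ (h₁.1 _) ?_), fun Γ ψ Δ h => .andL _ _ _ _ ?_⟩
    · rw [Multiset.cons_swap]; exact h₂.1 _
    · rw [Multiset.cons_swap φ₂, Multiset.cons_swap φ₁]
      refine .andImpL _ _ _ _ _ ?_
      rw [Multiset.cons_swap]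
      refine h₁.2 _ _ _ ?_
      rw [Multiset.cons_swap]
      exact h₂.2 _ _ _ h
  | or φ₁ φ₂ h₁ h₂ =>
    refine ⟨fun Γ => .orL _ _ _ _ (.orR1 _ _ _ (h₁.1 _)) (.orR2 _ _ _ (h₂.1 _)),
      fun Γ ψ Δ h => .orL _ _ _ _ ?_ ?_⟩
    · rw [Multiset.cons_swap]
      refine .orImpL _ _ _ _ _ ?_
      rw [Multiset.cons_swap, Multiset.cons_swap _ φ₁, Multiset.cons_swap _ φ₁]
      rw [Multiset.cons_swap (φ₂.imp ψ)]
      exact h₁.2 _ _ _ (by rw [Multiset.cons_swap]; exact h.weaken _)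
    · rw [Multiset.cons_swap]
      refine .orImpL _ _ _ _ _ ?_
      rw [Multiset.cons_swap _ φ₂, Multiset.cons_swap _ φ₂]
      rw [Multiset.cons_swap (φ₁.imp ψ)]
      exact h₂.2 _ _ _ (by rw [Multiset.cons_swap]; exact h.weaken _)
  | imp φ₁ φ₂ h₁ h₂ =>
    have hid : ∀ Γ, G4 w c (Form.imp φ₁ φ₂ ::ₘ Γ) (some (Form.imp φ₁ φ₂)) :=
      fun Γ => .impR _ _ _ (h₁.2 _ _ _ (h₂.1 _))
    refine ⟨hid, fun Γ ψ Δ h => ?_⟩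
    rw [Multiset.cons_swap]
    refine .impImpL _ _ _ _ _ ((hid _).weaken _) ?_
    rw [Multiset.cons_swap]
    exact h.weaken _
  | box φ h₁ =>
    refine ⟨fun Γ => .boxR _ _ ?_, fun Γ ψ Δ h => ?_⟩
    · rw [boxInv_cons_box]; exact h₁.1 _
    · rw [Multiset.cons_swap]
      refine .boxImpL _ _ _ _ ?_ ?_
      · rw [boxInv_cons_box]; exact h₁.1 _
      · rw [Multiset.cons_swap]; exact h.weaken _
  | dia φ h₁ =>
    refine ⟨fun Γ => .diaL _ _ _ (h₁.1 _), fun Γ ψ Δ h => ?_⟩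
    rw [Multiset.cons_swap]
    refine .diaImpL _ _ _ _ _ (h₁.1 _) ?_
    rw [Multiset.cons_swap]
    exact h.weaken _

theorem id_mem (h : φ ∈ Γ) : G4 w c Γ (some φ) := by
  obtain ⟨Γ, rfl⟩ := Multiset.exists_cons_of_mem h
  exact (id_and_impL φ).1 Γ

/-! ### Consequences of the cut rule -/

theorem trans (h : G4 w true Γ Δ) (hΓ : ∀ φ ∈ Γ, G4 w true Γ' (some φ)) : G4 w true Γ' Δ := by
  replace h := h.weaken_add Γ'
  induction Γ using Multiset.induction with
  | empty => simpa using h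
  | cons φ Γ ih =>
    refine ih (fun ψ hψ => hΓ ψ (Multiset.mem_cons_of_mem hψ)) (.cut _ φ _ rfl ?_ ?_)
    · rw [Multiset.add_comm]
      exact (hΓ φ (Multiset.mem_cons_self _ _)).weaken_add Γ
    · rwa [← Multiset.cons_add]

theorem mono (h : G4 w true Γ Δ) (hΓ : ∀ φ ∈ Γ, φ ∈ Γ') : G4 w true Γ' Δ :=
  h.trans fun φ hφ => id_mem (hΓ φ hφ)

theorem mp (h : G4 w true Γ (some (φ.imp ψ))) (k : G4 w true Γ (some φ)) :
    G4 w true Γ (some ψ) :=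
  .cut _ _ _ rfl h (.cut _ _ _ rfl (k.weaken _) ((id_and_impL φ).2 _ _ _ ((id_and_impL ψ).1 _)))

theorem impR_inv (h : G4 w true Γ (some (φ.imp ψ))) : G4 w true (φ ::ₘ Γ) (some ψ) :=
  (h.weaken φ).mp (id_mem (Multiset.mem_cons_self _ _))

theorem and_left (h : G4 w true Γ (some (φ.and ψ))) : G4 w true Γ (some φ) :=
  .cut _ _ _ rfl h (.andL _ _ _ _ (id_mem (by simp)))

theorem and_right (h : G4 w true Γ (some (φ.and ψ))) : G4 w true Γ (some ψ) :=
  .cut _ _ _ rfl h (.andL _ _ _ _ (id_mem (by simp)))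

/-- Replacing a formula of the antecedent by formulas that entail it. -/
theorem replace (h : G4 w true (φ ::ₘ Γ) Δ) (hφ : G4 w true Γ' (some φ))
    (hΓ : ∀ ψ ∈ Γ, ψ ∈ Γ') : G4 w true Γ' Δ := by
  refine h.trans fun ψ hψ => ?_
  rcases Multiset.mem_cons.1 hψ with rfl | hψ
  · exact hφ
  · exact id_mem (hΓ ψ hψ)

end G4

/-! ### A Kleene slash -/

/-- The Kleene slash relative to the antecedent `Γ`, for provability with cut. -/
def slash (w : Bool) (Γ : Multiset Form) : Form → Prop
  | .var n => Form.var n ∈ Γ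
  | .bot => False
  | .and φ ψ => slash w Γ φ ∧ slash w Γ ψ
  | .or φ ψ => slash w Γ φ ∨ slash w Γ ψ
  | .imp φ ψ => G4 w true Γ (some (φ.imp ψ)) ∧ (slash w Γ φ → slash w Γ ψ)
  | .box φ => G4 w true (boxInv Γ) (some φ)
  | .dia φ => ∃ γ, Form.dia γ ∈ Γ ∧ G4 w true (γ ::ₘ boxInv Γ) (some φ)

/-- The slash of a succedent; the empty succedent counts as falsity. -/
def slashSucc (w : Bool) (Γ : Multiset Form) : Option Form → Prop
  | none => False
  | some φ => slash w Γ φ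

theorem slash.provable {w : Bool} {Γ : Multiset Form} :
    ∀ {φ : Form}, slash w Γ φ → G4 w true Γ (some φ)
  | .var _, h => G4.id_mem h
  | .bot, h => h.elim
  | .and _ _, h => .andR _ _ _ h.1.provable h.2.provable
  | .or _ _, h => h.elim (fun h => .orR1 _ _ _ h.provable) (fun h => .orR2 _ _ _ h.provable)
  | .imp _ _, h => h.1
  | .box _, h => .boxR _ _ h
  | .dia φ, h => by
    obtain ⟨γ, hγ, h⟩ := h
    obtain ⟨Γ, rfl⟩ := Multiset.exists_cons_of_mem hγ
    refine .diaL _ _ _ (h.mono ?_)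
    simp [mem_boxInv]

theorem slash_of_provable {w : Bool} {Γ : Multiset Form}
    (hN : w = true → ∀ γ, Form.dia γ ∈ Γ → ¬ G4 w true (γ ::ₘ boxInv Γ) none)
    {Γ' : Multiset Form} {Δ : Option Form} (h : G4 w true Γ' Δ) :
    (∀ φ ∈ Γ', slash w Γ φ) → slashSucc w Γ Δ := by
  have hbox : ∀ Γ', (∀ φ ∈ Γ', slash w Γ φ) → ∀ φ ∈ boxInv Γ', G4 w true (boxInv Γ) (some φ) :=
    fun Γ' hS φ hφ => hS _ (mem_boxInv.1 hφ)
  have hdia : ∀ Γ' φ Δ, (∀ φ ∈ Γ', slash w Γ φ) → slash w Γ φ.dia →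
      G4 w true (φ ::ₘ boxInv Γ') Δ → ∃ γ, Form.dia γ ∈ Γ ∧ G4 w true (γ ::ₘ boxInv Γ) Δ := by
    rintro Γ' φ Δ hS ⟨γ, hγ, hφ⟩ h
    refine ⟨γ, hγ, h.trans fun ψ hψ => ?_⟩
    rcases Multiset.mem_cons.1 hψ with rfl | hψ
    · exact hφ
    · exact (hbox _ hS _ hψ).weaken _
  induction h with
  | botL => exact fun hS => (hS _ (Multiset.mem_cons_self _ _)).elim
  | idP => exact fun hS => hS _ (Multiset.mem_cons_self _ _)
  | andL _ _ _ _ _ h =>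
    intro hS
    simp only [Multiset.forall_mem_cons] at *
    exact h ⟨hS.1.1, hS.1.2, hS.2⟩
  | andR _ _ _ _ _ h k => exact fun hS => ⟨h hS, k hS⟩
  | orL _ _ _ _ _ _ h k =>
    intro hS
    simp only [Multiset.forall_mem_cons] at *
    exact hS.1.elim (fun hφ => h ⟨hφ, hS.2⟩) (fun hψ => k ⟨hψ, hS.2⟩)
  | orR1 _ _ _ _ h => exact fun hS => Or.inl (h hS)
  | orR2 _ _ _ _ h => exact fun hS => Or.inr (h hS)
  | impR Γ' φ ψ h' h =>
    refine fun hS => ⟨(G4.impR _ _ _ h').trans fun χ hχ => (hS χ hχ).provable, fun hφ => h ?_⟩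
    exact Multiset.forall_mem_cons.2 ⟨hφ, hS⟩
  | andImpL _ φ ψ χ _ _ h =>
    intro hS
    simp only [Multiset.forall_mem_cons] at *
    refine h ⟨⟨.impR _ _ _ (.impR _ _ _ ?_), fun hφ => ⟨.impR _ _ _ ?_, fun hψ => ?_⟩⟩, hS.2⟩
    · exact ((hS.1.1.weaken _).weaken _).mp
        (.andR _ _ _ (G4.id_mem (by simp)) (G4.id_mem (by simp)))
    · exact (hS.1.1.weaken _).mp (.andR _ _ _ (hφ.provable.weaken _) (G4.id_mem (by simp)))
    · exact hS.1.2 ⟨hφ, hψ⟩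
  | orImpL _ φ ψ χ _ _ h =>
    intro hS
    simp only [Multiset.forall_mem_cons] at *
    refine h ⟨⟨.impR _ _ _ ?_, fun hφ => hS.1.2 (Or.inl hφ)⟩,
      ⟨.impR _ _ _ ?_, fun hψ => hS.1.2 (Or.inr hψ)⟩, hS.2⟩
    · exact (hS.1.1.weaken _).mp (.orR1 _ _ _ (G4.id_mem (by simp)))
    · exact (hS.1.1.weaken _).mp (.orR2 _ _ _ (G4.id_mem (by simp)))
  | pImpL _ _ _ _ _ h =>
    intro hS
    simp only [Multiset.forall_mem_cons] at *
    exact h ⟨hS.1, hS.2.1.2 hS.1, hS.2.2⟩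
  | impImpL _ φ ψ χ _ _ _ h k =>
    intro hS
    simp only [Multiset.forall_mem_cons] at *
    refine k ⟨hS.1.2 (h ⟨⟨.impR _ _ _ ?_, fun hψ => hS.1.2 ⟨?_, fun _ => hψ⟩⟩, hS.2⟩), hS.2⟩
    · exact (hS.1.1.weaken _).mp (.impR _ _ _ (G4.id_mem (by simp)))
    · exact .impR _ _ _ (hψ.provable.weaken _)
  | boxR _ _ h' _ => exact fun hS => h'.trans (hbox _ hS)
  | boxImpL Γ' φ ψ _ h' _ _ k =>
    intro hS
    simp only [Multiset.forall_mem_cons] at hS k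
    exact k ⟨hS.1.2 (h'.trans (hbox _ hS.2)), hS.2⟩
  | diaImpL Γ' γ φ ψ _ h' _ _ k =>
    intro hS
    simp only [Multiset.forall_mem_cons] at hS k
    exact k ⟨hS.1.2 (hdia _ _ _ hS.2.2 hS.2.1 h'), hS.2⟩
  | diaL Γ' φ ψ h' _ =>
    intro hS
    rw [Multiset.forall_mem_cons] at hS
    exact hdia _ _ _ hS.2 hS.1 h'
  | diaN Γ' φ Δ hw h' _ =>
    intro hS
    rw [Multiset.forall_mem_cons] at hS
    obtain ⟨γ, hγ, h⟩ := hdia _ _ _ hS.2 hS.1 h'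
    rcases Δ with _ | δ
    · exact hN hw γ hγ h
    · cases δ with
      | dia => exact ⟨γ, hγ, h⟩
      | _ => exact (hN hw γ hγ h).elim
  | cut _ _ _ _ _ _ h k =>
    exact fun hS => k (Multiset.forall_mem_cons.2 ⟨h hS, hS⟩)

/-! ### A termination measure for backward proof search -/

/-- The weight of a formula. -/
def Form.weight : Form → ℕ
  | .var _ => 1
  | .bot => 1
  | .and φ ψ => φ.weight + ψ.weight + 2
  | .or φ ψ => φ.weight + ψ.weight + 1
  | .imp φ ψ => φ.weight + ψ.weight + 1
  | .box φ => φ.weight + 1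
  | .dia φ => φ.weight + 1

/-- The cost of a formula: large enough that two formulas of smaller weight cost less. -/
def Form.cost (φ : Form) : ℕ := 4 ^ φ.weight

theorem Form.weight_pos (φ : Form) : 0 < φ.weight := by
  cases φ <;> simp [Form.weight]

theorem Form.cost_lt {φ ψ : Form} (h : φ.weight < ψ.weight) : φ.cost < ψ.cost :=
  Nat.pow_lt_pow_right (by norm_num) h

theorem Form.cost_add_lt {φ ψ χ : Form} (h : φ.weight < χ.weight) (k : ψ.weight < χ.weight) :
    φ.cost + ψ.cost < χ.cost := by
  have h' : 4 * φ.cost ≤ χ.cost := by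
    unfold Form.cost
    rw [← pow_succ']
    exact Nat.pow_le_pow_right (by norm_num) h
  have k' : 4 * ψ.cost ≤ χ.cost := by
    unfold Form.cost
    rw [← pow_succ']
    exact Nat.pow_le_pow_right (by norm_num) k
  have : 0 < φ.cost := Nat.pow_pos (by norm_num)
  omega

/-- The cost of a multiset of formulas. -/
def costM (Γ : Multiset Form) : ℕ := (Γ.map Form.cost).sum

/-- The cost of a succedent. -/
def costO : Option Form → ℕ
  | none => 0
  | some φ => φ.cost

@[simp]
theorem costM_cons (φ : Form) (Γ : Multiset Form) : costM (φ ::ₘ Γ) = φ.cost + costM Γ := by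
  simp [costM]

@[simp]
theorem costO_some (φ : Form) : costO (some φ) = φ.cost := rfl

theorem costM_boxInv_le (Γ : Multiset Form) : costM (boxInv Γ) ≤ costM Γ := by
  induction Γ using Multiset.induction with
  | empty => simp [boxInv]
  | cons φ Γ ih =>
    cases φ with
    | box φ =>
      have : φ.cost < φ.box.cost := Form.cost_lt (by simp [Form.weight])
      rw [boxInv_cons_box]
      simp only [costM_cons]
      omega
    | _ =>
      rw [boxInv, Multiset.filterMap_cons_none _ _ rfl, costM_cons]
      exact ih.trans (Nat.le_add_left _ _)

theorem costO_diaInv_le (Δ : Option Form) : costO (diaInv Δ) ≤ costO Δ := by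
  rcases Δ with _ | δ
  · exact le_rfl
  · cases δ with
    | dia φ => exact (Form.cost_lt (by simp [Form.weight])).le
    | _ => exact Nat.zero_le _

/-! ### Cut elimination -/

theorem G4.cut_free {w : Bool} {Γ : Multiset Form} {Δ : Option Form} (h : G4 w true Γ Δ) :
    G4 w false Γ Δ := by
  induction hn : costM Γ + costO Δ using Nat.strong_induction_on generalizing Γ Δ with
  | _ n ih =>
  subst hn
  replace ih : ∀ Γ' Δ', costM Γ' + costO Δ' < costM Γ + costO Δ → G4 w true Γ' Δ' →
      G4 w false Γ' Δ' := fun Γ' Δ' hlt h' => ih _ hlt h' rfl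
  by_contra hcon
  have hN : w = true → ∀ γ, Form.dia γ ∈ Γ → ¬ G4 w true (γ ::ₘ boxInv Γ) none := by
    intro hw γ hγ h'
    obtain ⟨Γ, rfl⟩ := Multiset.exists_cons_of_mem hγ
    refine hcon (.diaN _ _ _ hw (ih _ _ ?_ ?_))
    · have := costM_boxInv_le Γ
      have := costO_diaInv_le Δ
      have : γ.cost < γ.dia.cost := Form.cost_lt (by simp [Form.weight])
      simp only [costM_cons]
      omega
    · exact (h'.weaken_right rfl _).mono (by simp [mem_boxInv])
  have hΓ : ∀ φ ∈ Γ, slash w Γ φ := by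
    intro φ hφ
    obtain ⟨Γ₀, hΓ₀⟩ := Multiset.exists_cons_of_mem hφ
    have hright : ∀ α β, φ = Form.imp α β →
        G4 w true (β ::ₘ Γ₀) Δ ∧ G4 w false (β ::ₘ Γ₀) Δ := by
      rintro α β rfl
      rw [hΓ₀] at h
      have hβ : G4 w true (β ::ₘ Γ₀) Δ :=
        h.replace (.impR _ _ _ (G4.id_mem (by simp))) (by simp +contextual)
      refine ⟨hβ, ih _ _ ?_ hβ⟩
      have : β.cost < (α.imp β).cost := Form.cost_lt (by simp only [Form.weight]; omega)
      simp only [hΓ₀, costM_cons]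
      omega
    cases φ with
    | var n => exact hφ
    | bot => subst hΓ₀; exact (hcon (.botL _ _)).elim
    | and φ ψ =>
      subst hΓ₀
      refine (hcon (.andL _ _ _ _ (ih _ _ ?_ ?_))).elim
      · have : φ.cost + ψ.cost < (φ.and ψ).cost :=
          Form.cost_add_lt (by simp only [Form.weight]; omega) (by simp only [Form.weight]; omega)
        simp only [costM_cons]
        omega
      · exact h.replace (.andR _ _ _ (G4.id_mem (by simp)) (G4.id_mem (by simp)))
          (by simp +contextual)
    | or φ ψ =>
      subst hΓ₀
      refine (hcon (.orL _ _ _ _ (ih _ _ ?_ ?_) (ih _ _ ?_ ?_))).elim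
      · have : φ.cost < (φ.or ψ).cost := Form.cost_lt (by simp only [Form.weight]; omega)
        simp only [costM_cons]
        omega
      · exact h.replace (.orR1 _ _ _ (G4.id_mem (by simp))) (by simp +contextual)
      · have : ψ.cost < (φ.or ψ).cost := Form.cost_lt (by simp only [Form.weight]; omega)
        simp only [costM_cons]
        omega
      · exact h.replace (.orR2 _ _ _ (G4.id_mem (by simp))) (by simp +contextual)
    | box φ => exact G4.id_mem (mem_boxInv.2 hφ)
    | dia φ => exact ⟨φ, hφ, G4.id_mem (Multiset.mem_cons_self _ _)⟩
    | imp α χ =>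
      refine ⟨G4.id_mem hφ, fun hα => ?_⟩
      obtain ⟨hχ, hχ'⟩ := hright _ _ rfl
      cases α with
      | bot => exact hα.elim
      | var n =>
        have hn : Form.var n ∈ Γ₀ := by simpa [slash, hΓ₀] using hα
        obtain ⟨Γ₁, rfl⟩ := Multiset.exists_cons_of_mem hn
        rw [hΓ₀, Multiset.cons_swap] at hcon
        rw [Multiset.cons_swap] at hχ'
        exact (hcon (.pImpL _ _ _ _ hχ')).elim
      | and φ ψ =>
        subst hΓ₀
        refine (hcon (.andImpL _ _ _ _ _ (ih _ _ ?_ ?_))).elim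
        · have : (φ.imp (ψ.imp χ)).cost < ((φ.and ψ).imp χ).cost :=
            Form.cost_lt (by simp only [Form.weight]; omega)
          simp only [costM_cons]
          omega
        · refine h.replace (.impR _ _ _ ?_) (by simp +contextual)
          have hi : G4 w true (φ.and ψ ::ₘ φ.imp (ψ.imp χ) ::ₘ Γ₀) (some (φ.and ψ)) :=
            G4.id_mem (by simp)
          exact (G4.mp (G4.id_mem (by simp)) hi.and_left).mp hi.and_right
      | or φ ψ =>
        subst hΓ₀
        refine (hcon (.orImpL _ _ _ _ _ (ih _ _ ?_ ?_))).elim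
        · have : (φ.imp χ).cost + (ψ.imp χ).cost < ((φ.or ψ).imp χ).cost :=
            Form.cost_add_lt (by have := ψ.weight_pos; simp only [Form.weight]; omega)
              (by have := φ.weight_pos; simp only [Form.weight]; omega)
          simp only [costM_cons]
          omega
        · refine h.replace (.impR _ _ _ (.orL _ _ _ _ ?_ ?_)) (by simp +contextual)
          · exact G4.mp (φ := φ) (G4.id_mem (by simp)) (G4.id_mem (by simp))
          · exact G4.mp (φ := ψ) (G4.id_mem (by simp)) (G4.id_mem (by simp))
      | imp φ ψ =>
        have hα := hα.1
        subst hΓ₀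
        refine (hcon (.impImpL _ _ _ _ _ (ih _ _ ?_ ?_) hχ')).elim
        · have : (ψ.imp χ).cost + (φ.imp ψ).cost < ((φ.imp ψ).imp χ).cost :=
            Form.cost_add_lt (by have := φ.weight_pos; simp only [Form.weight]; omega)
              (by have := χ.weight_pos; simp only [Form.weight]; omega)
          simp only [costM_cons, costO_some]
          omega
        · refine .impR _ _ _ ?_
          have hα' : G4 w true ((φ.imp ψ).imp χ ::ₘ φ ::ₘ Γ₀) (some ψ) := by
            rw [Multiset.cons_swap]
            exact hα.impR_inv
          refine hα'.replace (.impR _ _ _ ?_) (by simp +contextual)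
          exact G4.mp (φ := ψ) (G4.id_mem (by simp))
            (G4.mp (φ := φ) (G4.id_mem (by simp)) (G4.id_mem (by simp)))
      | box φ =>
        have hα : G4 w true (boxInv Γ) (some φ) := hα
        subst hΓ₀
        refine (hcon (.boxImpL _ _ _ _ (ih _ _ ?_ ?_) hχ')).elim
        · have : φ.cost < (φ.box.imp χ).cost := Form.cost_lt (by simp only [Form.weight]; omega)
          have := costM_boxInv_le Γ₀
          simp only [costM_cons, costO_some]
          omega
        · exact hα.mono (by simp [mem_boxInv])
      | dia φ =>
        obtain ⟨γ, hγ, hα⟩ := hα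
        have hγ : Form.dia γ ∈ Γ₀ := by simpa [hΓ₀] using hγ
        obtain ⟨Γ₁, rfl⟩ := Multiset.exists_cons_of_mem hγ
        subst hΓ₀
        refine (hcon (.diaImpL _ _ _ _ _ (ih _ _ ?_ ?_) hχ')).elim
        · have : φ.cost < (φ.dia.imp χ).cost := Form.cost_lt (by simp only [Form.weight]; omega)
          have : γ.cost < γ.dia.cost := Form.cost_lt (by simp [Form.weight])
          have := costM_boxInv_le Γ₁
          simp only [costM_cons, costO_some]
          omega
        · exact hα.mono (by simp [mem_boxInv])
  have hΔ := slash_of_provable hN h hΓ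
  rcases Δ with _ | δ
  · exact hΔ
  have hlt : ∀ δ', δ'.weight < δ.weight → G4 w true Γ (some δ') → G4 w false Γ (some δ') := by
    intro δ' hw h'
    refine ih _ _ ?_ h'
    have := Form.cost_lt hw
    simp only [costO_some]
    omega
  cases δ with
  | var n =>
    obtain ⟨Γ, rfl⟩ := Multiset.exists_cons_of_mem (show Form.var n ∈ Γ from hΔ)
    exact hcon (.idP _ _)
  | bot => exact hΔ
  | and φ ψ =>
    exact hcon (.andR _ _ _ (hlt _ (by simp only [Form.weight]; omega) h.and_left)
      (hlt _ (by simp only [Form.weight]; omega) h.and_right))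
  | or φ ψ =>
    rcases hΔ with hΔ | hΔ
    · exact hcon (.orR1 _ _ _ (hlt _ (by simp only [Form.weight]; omega) hΔ.provable))
    · exact hcon (.orR2 _ _ _ (hlt _ (by simp only [Form.weight]; omega) hΔ.provable))
  | imp φ ψ =>
    refine hcon (.impR _ _ _ (ih _ _ ?_ h.impR_inv))
    have : φ.cost + ψ.cost < (φ.imp ψ).cost :=
      Form.cost_add_lt (by simp only [Form.weight]; omega) (by simp only [Form.weight]; omega)
    simp only [costM_cons, costO_some]
    omega
  | box φ =>
    refine hcon (.boxR _ _ (ih _ _ ?_ hΔ))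
    have : φ.cost < φ.box.cost := Form.cost_lt (by simp [Form.weight])
    have := costM_boxInv_le Γ
    simp only [costO_some]
    omega
  | dia φ =>
    obtain ⟨γ, hγ, hΔ⟩ := hΔ
    obtain ⟨Γ, rfl⟩ := Multiset.exists_cons_of_mem hγ
    refine hcon (.diaL _ _ _ (ih _ _ ?_ (hΔ.mono (by simp [mem_boxInv]))))
    have : φ.cost < φ.dia.cost := Form.cost_lt (by simp [Form.weight])
    have : γ.cost < γ.dia.cost := Form.cost_lt (by simp [Form.weight])
    have := costM_boxInv_le Γ
    simp only [costM_cons, costO_some]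
    omega

/-- G4CK and G4WK eliminate cut: every sequent provable in the calculus
augmented with the additive cut rule is provable without cut. -/
theorem cut_elimination :
    (∀ (Γ : Multiset Form) (δ : Form), G4CKc Γ δ → G4CK Γ δ) ∧
    (∀ (Γ : Multiset Form) (Δ : Option Form), G4WKc Γ Δ → G4WK Γ Δ) :=
  ⟨fun _ δ h => h.toG4.cut_free.toG4CK δ rfl, fun _ _ h => h.toG4.cut_free.toG4WK⟩
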